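/- arXiv:2203.14343 — 2 statements merged into one kernel-verified Lean document; each statement's English description precedes it below -/
import Mathlib

section
/- Let N, L be positive integers, Δ > 0 a real number, and let A ∈ ℂ^{N×N} be diagonalizable as A = V·Λ·V^{−1} where Λ = diag(λ_1, …, λ_N), every eigenvalue satisfies λ_i ≠ 0, and additionally exp(L·λ_i·Δ) ≠ 1 for every i. Let B ∈ ℂ^N be a column vector and C ∈ ℂ^N a row vector, define w̃ ∈ ℂ^N by w̃_i = (C·V)_i · (V^{−1}·B)_i, and define w ∈ ℂ^N by w_i = w̃_i · (exp(L·λ_i·Δ) − 1). Then for every 0 ≤ k < L, K̄_{Δ,L}(A, B, C)_k = K̄_{Δ,L}(Λ, B', w)_k, where B' ∈ ℂ^N is the column vector with entries B'_i = (exp(L·λ_i·Δ) − 1)^{−1}. -/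
open Matrix NormedSpace Finset

/-- The SSM kernel `K̄_{Δ,L}(A,B,C)_k = C · exp(kΔA) · (exp(ΔA) − I) · A⁻¹ · B`,
as a function of the position `k` (positions `0 ≤ k < L` are the entries of the kernel). -/
noncomputable def ssmKernel {N : ℕ} (Δ : ℝ) (A : Matrix (Fin N) (Fin N) ℂ)
    (B C : Fin N → ℂ) (k : ℕ) : ℂ :=
  C ⬝ᵥ ((exp (((k : ℂ) * (Δ : ℂ)) • A) * (exp ((Δ : ℂ) • A) - 1) * A⁻¹) *ᵥ B)

/-- A change of basis `A = V D V⁻¹` of the state space leaves the kernel unchanged. -/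
theorem ssmKernel_conj {N : ℕ} (Δ : ℝ) {V : Matrix (Fin N) (Fin N) ℂ} (hV : IsUnit V)
    (D : Matrix (Fin N) (Fin N) ℂ) (B C : Fin N → ℂ) (k : ℕ) :
    ssmKernel Δ (V * D * V⁻¹) B C k = ssmKernel Δ D (V⁻¹ *ᵥ B) (C ᵥ* V) k := by
  have hdet : IsUnit V.det := (Matrix.isUnit_iff_isUnit_det V).mp hV
  have hVV : V⁻¹ * V = 1 := Matrix.nonsing_inv_mul V hdet
  have hVV' : V * V⁻¹ = 1 := Matrix.mul_nonsing_inv V hdet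
  have hexp (c : ℂ) : exp (c • (V * D * V⁻¹)) = V * exp (c • D) * V⁻¹ := by
    rw [← Matrix.exp_conj V _ hV, Matrix.mul_smul, Matrix.smul_mul]
  have hsub : V * exp ((Δ : ℂ) • D) * V⁻¹ - 1 = V * (exp ((Δ : ℂ) • D) - 1) * V⁻¹ := by
    rw [mul_sub, sub_mul, mul_one, hVV']
  have hinv : (V * D * V⁻¹)⁻¹ = V * D⁻¹ * V⁻¹ := by
    rw [Matrix.mul_inv_rev, Matrix.mul_inv_rev, Matrix.nonsing_inv_nonsing_inv V hdet, mul_assoc]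
  have hcancel (X Y : Matrix (Fin N) (Fin N) ℂ) :
      V * X * V⁻¹ * (V * Y * V⁻¹) = V * (X * Y) * V⁻¹ := by
    calc V * X * V⁻¹ * (V * Y * V⁻¹) = V * X * (V⁻¹ * V) * Y * V⁻¹ := by
          simp only [mul_assoc]
      _ = V * (X * Y) * V⁻¹ := by rw [hVV, mul_one, mul_assoc V X Y]
  simp only [ssmKernel, hexp, hsub, hinv, hcancel, ← Matrix.mulVec_mulVec,
    Matrix.dotProduct_mulVec, Matrix.vecMul_vecMul]

/-- The kernel of a diagonal state matrix is a sum over its modes. -/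
theorem ssmKernel_diagonal {N : ℕ} (Δ : ℝ) {lam : Fin N → ℂ} (hlam : ∀ i, lam i ≠ 0)
    (B C : Fin N → ℂ) (k : ℕ) :
    ssmKernel Δ (diagonal lam) B C k =
      ∑ i, C i * (Complex.exp (k * Δ * lam i) * (Complex.exp (Δ * lam i) - 1) * (lam i)⁻¹ *
        B i) := by
  have hexp (c : ℂ) : exp (c • diagonal lam) = diagonal fun i => Complex.exp (c * lam i) := by
    rw [← Matrix.diagonal_smul, Matrix.exp_diagonal]
    congr 1
    ext i
    simp [Pi.coe_exp, Complex.exp_eq_exp_ℂ]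
  have hinv : (diagonal lam)⁻¹ = diagonal fun i => (lam i)⁻¹ := by
    apply Matrix.inv_eq_right_inv
    simp [Matrix.diagonal_mul_diagonal, hlam]
  simp only [ssmKernel, hexp, hinv, ← Matrix.diagonal_one, Matrix.diagonal_sub, dotProduct,
    Matrix.diagonal_mul_diagonal, Matrix.mulVec_diagonal]

theorem dss_kernel_part_b {N L : ℕ} (hN : 0 < N) (hL : 0 < L) (Δ : ℝ) (hΔ : 0 < Δ)
    (A V : Matrix (Fin N) (Fin N) ℂ) (hV : IsUnit V)
    (lam : Fin N → ℂ) (hlam : ∀ i, lam i ≠ 0)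
    (hexp : ∀ i, Complex.exp ((L : ℂ) * lam i * (Δ : ℂ)) ≠ 1)
    (hA : A = V * Matrix.diagonal lam * V⁻¹)
    (B C : Fin N → ℂ) (wt w : Fin N → ℂ)
    (hwt : ∀ i, wt i = (V.vecMul C) i * (V⁻¹ *ᵥ B) i)
    (hw : ∀ i, w i = wt i * (Complex.exp ((L : ℂ) * lam i * (Δ : ℂ)) - 1)) :
    ∀ k < L, ssmKernel Δ A B C k =
      ssmKernel Δ (Matrix.diagonal lam)
        (fun i => (Complex.exp ((L : ℂ) * lam i * (Δ : ℂ)) - 1)⁻¹) w k := by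
  intro k _
  rw [hA, ssmKernel_conj Δ hV, ssmKernel_diagonal Δ hlam, ssmKernel_diagonal Δ hlam]
  refine Finset.sum_congr rfl fun i _ => ?_
  have hne := sub_ne_zero.mpr (hexp i)
  rw [hw, hwt]
  generalize Complex.exp (L * lam i * Δ) - 1 = z at hne ⊢
  field_simp
end

section
/- Let ε > 0 be a real number, L a positive integer, and x ∈ ℂ^L. Let m = x_{i*} where i* is any index maximizing Re(x_i) over 0 ≤ i < L, and set x̃_i = x_i − m. Define softmax_ε(x) ∈ ℂ^L by softmax_ε(x)_k = exp(x̃_k) · reciprocal_ε(Σ_{r=0}^{L−1} exp(x̃_r)), where reciprocal_ε(z) = conj(z)/(z·conj(z) + ε). Then for every 0 ≤ k < L, |softmax_ε(x)_k| ≤ 1/(2·√ε); in particular softmax_ε is defined (its denominator is nonzero) for every input x ∈ ℂ^L. -/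
open Complex Finset

/-- `reciprocal_ε(z) = conj(z) / (z · conj(z) + ε)`. -/
noncomputable def reciprocalEps (ε : ℝ) (z : ℂ) : ℂ :=
  (starRingEnd ℂ) z / (z * (starRingEnd ℂ) z + (ε : ℂ))

theorem mul_conj_add_ofReal (ε : ℝ) (z : ℂ) :
    z * (starRingEnd ℂ) z + (ε : ℂ) = ((‖z‖ ^ 2 + ε : ℝ) : ℂ) := by
  rw [Complex.mul_conj']
  push_cast
  rfl

theorem mul_conj_add_ofReal_ne_zero {ε : ℝ} (hε : 0 < ε) (z : ℂ) :
    z * (starRingEnd ℂ) z + (ε : ℂ) ≠ 0 := by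
  rw [mul_conj_add_ofReal, Complex.ofReal_ne_zero]
  positivity

theorem norm_reciprocalEps_le {ε : ℝ} (hε : 0 < ε) (z : ℂ) :
    ‖reciprocalEps ε z‖ ≤ 1 / (2 * Real.sqrt ε) := by
  have hd : 0 < ‖z‖ ^ 2 + ε := by positivity
  rw [reciprocalEps, mul_conj_add_ofReal, norm_div, Complex.norm_conj, Complex.norm_real,
    Real.norm_of_nonneg hd.le, div_le_div_iff₀ hd (by positivity)]
  nlinarith [sq_nonneg (‖z‖ - Real.sqrt ε), Real.sq_sqrt hε.le]

theorem softmax_eps_bounded (ε : ℝ) (hε : 0 < ε) (L : ℕ) (hL : 0 < L)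
    (x : Fin L → ℂ) (istar : Fin L) (hmax : ∀ i, (x i).re ≤ (x istar).re) :
    ((∑ r : Fin L, Complex.exp (x r - x istar)) *
        (starRingEnd ℂ) (∑ r : Fin L, Complex.exp (x r - x istar)) + (ε : ℂ) ≠ 0) ∧
    ∀ k : Fin L,
      ‖Complex.exp (x k - x istar) *
          reciprocalEps ε (∑ r : Fin L, Complex.exp (x r - x istar))‖ ≤
        1 / (2 * Real.sqrt ε) := by
  refine ⟨mul_conj_add_ofReal_ne_zero hε _, fun k => ?_⟩
  have hk : ‖Complex.exp (x k - x istar)‖ ≤ 1 := by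
    rw [Complex.norm_exp, Real.exp_le_one_iff, Complex.sub_re]
    exact sub_nonpos.mpr (hmax k)
  rw [norm_mul]
  exact (mul_le_of_le_one_left (norm_nonneg _) hk).trans (norm_reciprocalEps_le hε _)
end
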